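/- Let n ≥ 4 and a₁, a₂ > 0. There exist R₀ ≥ 8 and constants C₁, C₂ > 0, depending only on n, a₁ and a₂, with the following property. Let R ≥ R₀, λ ∈ [R, R+2], Γ ≥ 1 and ρ with 4λ ≤ ρ ≤ Γ; set Σ_λ = (B(0,ρ) ∩ ℝⁿ₊) ∖ cl(B(0,λ)), Ω_λ = {y ∈ Σ_λ : |y| ≤ 2λ and y₁ > 2·|(y₂,…,yₙ)|}, and e = (1,0,…,0). For y ∈ ℝⁿ let ȳ = (y₁,…,y_{n−1},−yₙ) and let Ḡ_λ(y,η) = G_λ(y,η) + G_λ(ȳ,η). Let Q : Σ_λ → ℝ be continuous and satisfy: Q(η) ≤ −a₁·Γ^{−1}·(|η|−λ)·(1+|η−λe|²)^{−(n+2)/2} for η ∈ Ω_λ; |Q(η)| ≤ a₂·Γ^{−1}·(|η|−λ) for η ∈ Ω_λ; and |Q(η)| ≤ a₂·Γ^{−1}·(|η|−λ)·|η|^{−n−2} for η ∈ Σ_λ ∖ Ω_λ. Define h₁(y) = ∫_{Σ_λ} Ḡ_λ(y,η)·Q(η) dη. Then for all y ∈ cl(Σ_λ) ∩ cl(ℝⁿ₊)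 with |y| > λ: if |y| ≤ 4λ then h₁(y) ≤ −C₁·Γ^{−1}·(|y|−λ)·λ^{−n}·log λ and |h₁(y)| ≤ C₂·Γ^{−1}·(|y|−λ)·λ²; and if |y| ≥ 4λ then h₁(y) ≤ −C₁·Γ^{−1}·|y|^{2−n}·λ^{−1}·log λ and |h₁(y)| ≤ C₂·Γ^{−1}·|y|^{2−n}·λ^{n+1}. -/

import Mathlib

open Metric Set MeasureTheory

noncomputable section

abbrev Euc (n : ℕ) := EuclideanSpace ℝ (Fin n)

/-- Index of the last coordinate. -/
def lastIdx (n : ℕ) (h0 : 0 < n) : Fin n := ⟨n - 1, by omega⟩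

/-- The open upper half-space `ℝⁿ₊ = {x : xₙ > 0}`. -/
def upperHalf (n : ℕ) (h0 : 0 < n) : Set (Euc n) := {x | 0 < x (lastIdx n h0)}

/-- Reflection `ȳ = (y₁, …, y_{n-1}, -yₙ)` across the hyperplane `{yₙ = 0}`. -/
def reflPt (n : ℕ) (h0 : 0 < n) (y : Euc n) : Euc n :=
  y - (2 * y (lastIdx n h0)) • EuclideanSpace.single (lastIdx n h0) (1 : ℝ)

/-- The inverted point `y^λ = λ²y/|y|²`. -/
def invPt {n : ℕ} (lam : ℝ) (y : Euc n) : Euc n := (lam ^ 2 / ‖y‖ ^ 2) • y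

/-- Surface measure `σₙ` of the unit sphere in `ℝⁿ` (equal to `n·vol(Bⁿ)`). -/
def sphereArea (n : ℕ) : ℝ :=
  (n : ℝ) * (volume (Metric.ball (0 : Euc n) 1)).toReal

/-- The Dirichlet Green's function of `-Δ` on `ℝⁿ ∖ cl(B(0,λ))`. -/
def greenG (n : ℕ) (lam : ℝ) (y η : Euc n) : ℝ :=
  (1 / (((n : ℝ) - 2) * sphereArea n)) *
    (‖y - η‖ ^ ((2 : ℝ) - (n : ℝ))
      - (‖y‖ / lam) ^ ((2 : ℝ) - (n : ℝ)) * ‖invPt lam y - η‖ ^ ((2 : ℝ) - (n : ℝ)))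

/-- The reflected Green's function `Ḡ_λ(y,η) = G_λ(y,η) + G_λ(ȳ,η)`. -/
def greenGbar (n : ℕ) (h0 : 0 < n) (lam : ℝ) (y η : Euc n) : ℝ :=
  greenG n lam y η + greenG n lam (reflPt n h0 y) η

/-- Euclidean norm of the last `n - 1` coordinates `|(y₂, …, yₙ)|`. -/
def tailNorm (n : ℕ) (h0 : 0 < n) (y : Euc n) : ℝ :=
  Real.sqrt (∑ i ∈ Finset.univ.erase (⟨0, h0⟩ : Fin n), (y i) ^ 2)

/-- The half-space domain `Σ_λ = (B(0,ρ) ∩ ℝⁿ₊) ∖ cl(B(0,λ))`. -/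
def SigSet (n : ℕ) (h0 : 0 < n) (lam ρ : ℝ) : Set (Euc n) :=
  (Metric.ball (0 : Euc n) ρ ∩ upperHalf n h0) \ Metric.closedBall (0 : Euc n) lam

/-- The cone region `Ω_λ ⊆ Σ_λ`. -/
def OmegaSet (n : ℕ) (h0 : 0 < n) (lam ρ : ℝ) : Set (Euc n) :=
  {y ∈ SigSet n h0 lam ρ | ‖y‖ ≤ 2 * lam ∧ 2 * tailNorm n h0 y < y (⟨0, h0⟩ : Fin n)}

lemma sphereArea_pos {n : ℕ} (hn : 4 ≤ n) : 0 < sphereArea n := by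
  have hv : 0 < (volume (Metric.ball (0 : Euc n) 1)).toReal :=
    ENNReal.toReal_pos (Metric.measure_ball_pos _ _ one_pos).ne' measure_ball_lt_top.ne
  have hn' : (0 : ℝ) < n := by exact_mod_cast (by omega : 0 < n)
  exact mul_pos hn' hv

/-- The normalising constant `1 / ((n - 2) σₙ)` of the Green's function. -/
def greenConst (n : ℕ) : ℝ := 1 / (((n : ℝ) - 2) * sphereArea n)

lemma greenConst_pos {n : ℕ} (hn : 4 ≤ n) : 0 < greenConst n := by
  have hn' : (4 : ℝ) ≤ n := by exact_mod_cast hn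
  exact one_div_pos.2 (mul_pos (by linarith) (sphereArea_pos hn))

lemma rpow_neg_tangent_le {a b q : ℝ} (ha : 0 < a) (hb : 0 < b) (hq : 0 < q) :
    b ^ (-q) - q * b ^ (-q - 1) * (a - b) ≤ a ^ (-q) := by
  have hab : 0 < a / b := by positivity
  have h1 : 1 - q * (a / b - 1) ≤ (a / b) ^ (-q) := by
    rw [Real.rpow_def_of_pos hab]
    have h2 := Real.add_one_le_exp (Real.log (a / b) * -q)
    have h3 := Real.log_le_sub_one_of_pos hab
    nlinarith
  have h4 : a ^ (-q) = b ^ (-q) * (a / b) ^ (-q) := by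
    rw [← Real.mul_rpow hb.le hab.le]
    congr 1
    field_simp
  have hbq : 0 < b ^ (-q) := Real.rpow_pos_of_pos hb _
  rw [h4, Real.rpow_sub hb, Real.rpow_one]
  calc b ^ (-q) - q * (b ^ (-q) / b) * (a - b) = b ^ (-q) * (1 - q * (a / b - 1)) := by
        field_simp
    _ ≤ _ := mul_le_mul_of_nonneg_left h1 hbq.le

/-- The difference of the squared distances from `η` to the pole `y` and to its (rescaled)
inverted image. -/
def greenGap {n : ℕ} (lam : ℝ) (y η : Euc n) : ℝ :=
  (‖y‖ ^ 2 - lam ^ 2) * (‖η‖ ^ 2 - lam ^ 2) / lam ^ 2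

lemma sq_norm_invPt_sub {n : ℕ} {lam : ℝ} (hlam : 0 < lam) {y : Euc n} (hy : 0 < ‖y‖)
    (η : Euc n) :
    (‖y‖ / lam * ‖invPt lam y - η‖) ^ 2 = ‖y - η‖ ^ 2 + greenGap lam y η := by
  rw [mul_pow, invPt, norm_sub_sq_real, norm_sub_sq_real, norm_smul, inner_smul_left, greenGap,
    Real.norm_of_nonneg (by positivity)]
  simp only [conj_trivial]
  field_simp
  ring

lemma sq_rpow_neg_half {x : ℝ} (hx : 0 ≤ x) (n : ℕ) :
    (x ^ 2) ^ (-(((n : ℝ) - 2) / 2)) = x ^ ((2 : ℝ) - n) := by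
  rw [← Real.rpow_natCast_mul hx]
  congr 1
  push_cast
  ring

lemma greenG_eq {n : ℕ} {lam : ℝ} (hlam : 0 < lam) {y : Euc n} (hy : 0 < ‖y‖) (η : Euc n) :
    greenG n lam y η = greenConst n * ((‖y - η‖ ^ 2) ^ (-(((n : ℝ) - 2) / 2))
      - (‖y - η‖ ^ 2 + greenGap lam y η) ^ (-(((n : ℝ) - 2) / 2))) := by
  rw [← sq_norm_invPt_sub hlam hy, sq_rpow_neg_half (norm_nonneg _),
    sq_rpow_neg_half (by positivity), Real.mul_rpow (by positivity) (norm_nonneg _)]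
  rfl

lemma greenGap_nonneg {n : ℕ} {lam : ℝ} (hlam : 0 < lam) {y η : Euc n} (hy : lam ≤ ‖y‖)
    (hη : lam ≤ ‖η‖) : 0 ≤ greenGap lam y η := by
  unfold greenGap
  have h1 : 0 ≤ ‖y‖ ^ 2 - lam ^ 2 := by nlinarith
  have h2 : 0 ≤ ‖η‖ ^ 2 - lam ^ 2 := by nlinarith
  positivity

lemma greenG_nonneg {n : ℕ} (hn : 4 ≤ n) {lam : ℝ} (hlam : 0 < lam) {y η : Euc n}
    (hy : lam < ‖y‖) (hη : lam < ‖η‖) (hne : η ≠ y) : 0 ≤ greenG n lam y η := by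
  have hn' : (4 : ℝ) ≤ n := by exact_mod_cast hn
  have hA : 0 < ‖y - η‖ := norm_pos_iff.2 (sub_ne_zero.2 hne.symm)
  rw [greenG_eq hlam (hlam.trans hy)]
  refine mul_nonneg (greenConst_pos hn).le (sub_nonneg.2 ?_)
  exact Real.rpow_le_rpow_of_nonpos (by positivity)
    (by linarith [greenGap_nonneg hlam hy.le hη.le]) (by linarith)

lemma greenG_ge {n : ℕ} (hn : 4 ≤ n) {lam : ℝ} (hlam : 0 < lam) {y η : Euc n}
    (hy : lam < ‖y‖) (hη : lam < ‖η‖) (hne : η ≠ y) :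
    greenConst n * ((((n : ℝ) - 2) / 2) * (‖y‖ / lam * ‖invPt lam y - η‖) ^ (-(n : ℝ))
      * greenGap lam y η) ≤ greenG n lam y η := by
  have hn' : (4 : ℝ) ≤ n := by exact_mod_cast hn
  have hA : 0 < ‖y - η‖ := norm_pos_iff.2 (sub_ne_zero.2 hne.symm)
  have hD := greenGap_nonneg hlam hy.le hη.le
  have hy0 := hlam.trans hy
  rw [greenG_eq hlam hy0]
  refine mul_le_mul_of_nonneg_left ?_ (greenConst_pos hn).le
  have h := rpow_neg_tangent_le (a := ‖y - η‖ ^ 2) (b := ‖y - η‖ ^ 2 + greenGap lam y η)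
    (q := ((n : ℝ) - 2) / 2) (by positivity) (by positivity) (by linarith)
  have e : (‖y - η‖ ^ 2 + greenGap lam y η) ^ (-(((n : ℝ) - 2) / 2) - 1)
      = (‖y‖ / lam * ‖invPt lam y - η‖) ^ (-(n : ℝ)) := by
    rw [← sq_norm_invPt_sub hlam hy0, ← Real.rpow_natCast_mul (by positivity)]
    congr 1
    push_cast
    ring
  rw [e] at h
  linarith

lemma greenG_le_rpow {n : ℕ} (hn : 4 ≤ n) {lam : ℝ} (hlam : 0 < lam) {y η : Euc n}
    (hy : lam < ‖y‖) (hη : lam < ‖η‖) :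
    greenG n lam y η ≤ greenConst n * ‖y - η‖ ^ ((2 : ℝ) - n) := by
  have hD := greenGap_nonneg hlam hy.le hη.le
  rw [greenG_eq hlam (hlam.trans hy), sq_rpow_neg_half (norm_nonneg _)]
  refine mul_le_mul_of_nonneg_left ?_ (greenConst_pos hn).le
  linarith [Real.rpow_nonneg (by positivity : 0 ≤ ‖y - η‖ ^ 2 + greenGap lam y η)
    (-(((n : ℝ) - 2) / 2))]

lemma greenG_le_gap {n : ℕ} (hn : 4 ≤ n) {lam : ℝ} (hlam : 0 < lam) {y η : Euc n}
    (hy : lam < ‖y‖) (hη : lam < ‖η‖) (hne : η ≠ y) :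
    greenG n lam y η ≤ greenConst n * ((((n : ℝ) - 2) / 2) * ‖y - η‖ ^ ((2 : ℝ) - n)
      / ‖y - η‖ ^ 2 * greenGap lam y η) := by
  have hn' : (4 : ℝ) ≤ n := by exact_mod_cast hn
  have hA : 0 < ‖y - η‖ := norm_pos_iff.2 (sub_ne_zero.2 hne.symm)
  have hD := greenGap_nonneg hlam hy.le hη.le
  rw [greenG_eq hlam (hlam.trans hy)]
  refine mul_le_mul_of_nonneg_left ?_ (greenConst_pos hn).le
  have h := rpow_neg_tangent_le (a := ‖y - η‖ ^ 2 + greenGap lam y η) (b := ‖y - η‖ ^ 2)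
    (q := ((n : ℝ) - 2) / 2) (by positivity) (by positivity) (by linarith)
  rw [Real.rpow_sub (by positivity), Real.rpow_one, sq_rpow_neg_half (norm_nonneg _)] at h
  rw [sq_rpow_neg_half (norm_nonneg _)]
  rw [mul_div_assoc]
  linarith

lemma boundary_weight_le {A s t lam q W g : ℝ} (hA : 0 < A) (hlam : 0 < lam) (hs : lam < s)
    (ht : lam < t) (htri : t ≤ s + A) (hq : 0 < q) (hW : 0 ≤ W) (h1 : g ≤ W)
    (h2 : g ≤ q * W / A ^ 2 * ((s ^ 2 - lam ^ 2) * (t ^ 2 - lam ^ 2) / lam ^ 2)) :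
    (t - lam) * g ≤ (8 + 256 * q) * ((s - lam) / s) * t * W := by
  have hs0 := hlam.trans hs
  have ht0 := hlam.trans ht
  have hd : 0 < s - lam := by linarith
  have hδ : 0 < t - lam := by linarith
  rcases le_total (4 * lam) s with hs4 | hs4
  · have h3 : 1 ≤ 2 * ((s - lam) / s) := by
      rw [mul_div_assoc', le_div_iff₀ hs0]; linarith
    have hp : 0 < (s - lam) / s := by positivity
    have h4 : 1 ≤ (8 + 256 * q) * ((s - lam) / s) := by nlinarith
    calc (t - lam) * g ≤ (t - lam) * W := by gcongr
      _ ≤ 1 * t * W := by gcongr; linarith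
      _ ≤ _ := by gcongr
  rcases le_total A (s - lam) with hAd | hAd
  · have h3 : 1 / 4 ≤ t / s := by
      rw [div_le_div_iff₀ (by norm_num) hs0]; linarith
    calc (t - lam) * g ≤ (t - lam) * W := by gcongr
      _ ≤ (2 * (s - lam)) * W := by gcongr; linarith
      _ = 8 * (s - lam) * (1 / 4) * W := by ring
      _ ≤ (8 + 256 * q) * (s - lam) * (t / s) * W := by gcongr; linarith
      _ = _ := by ring
  · have hδA : t - lam ≤ 2 * A := by linarith
    have hsl : s / lam ^ 2 ≤ 16 / s := by
      rw [div_le_div_iff₀ (by positivity) hs0]; nlinarith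
    have hδ2 : (t - lam) ^ 2 / A ^ 2 ≤ 4 := by
      rw [div_le_iff₀ (by positivity)]; nlinarith
    have hgap : (s ^ 2 - lam ^ 2) * (t ^ 2 - lam ^ 2)
        ≤ ((s - lam) * (2 * s)) * ((t - lam) * (2 * t)) := by
      have h3 : s ^ 2 - lam ^ 2 ≤ (s - lam) * (2 * s) := by nlinarith
      have h4 : t ^ 2 - lam ^ 2 ≤ (t - lam) * (2 * t) := by nlinarith
      have h5 : 0 ≤ t ^ 2 - lam ^ 2 := by nlinarith
      exact mul_le_mul h3 h4 h5 (by positivity)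
    calc (t - lam) * g
        ≤ (t - lam) * (q * W / A ^ 2 * ((s ^ 2 - lam ^ 2) * (t ^ 2 - lam ^ 2) / lam ^ 2)) := by
          gcongr
      _ ≤ (t - lam) * (q * W / A ^ 2
            * (((s - lam) * (2 * s)) * ((t - lam) * (2 * t)) / lam ^ 2)) := by gcongr
      _ = 4 * q * W * (s - lam) * t * (s / lam ^ 2) * ((t - lam) ^ 2 / A ^ 2) := by
          field_simp; ring
      _ ≤ 4 * q * W * (s - lam) * t * (16 / s) * 4 := by
          exact mul_le_mul (mul_le_mul_of_nonneg_left hsl (by positivity)) hδ2 (by positivity)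
            (by positivity)
      _ = (256 * q) * ((s - lam) / s) * t * W := by ring
      _ ≤ _ := by gcongr; linarith

lemma dist_mul_greenG_le {n : ℕ} (hn : 4 ≤ n) {lam : ℝ} (hlam : 0 < lam) {y η : Euc n}
    (hy : lam < ‖y‖) (hη : lam < ‖η‖) (hne : η ≠ y) :
    (‖η‖ - lam) * greenG n lam y η ≤
      greenConst n * (8 + 256 * (((n : ℝ) - 2) / 2)) * ((‖y‖ - lam) / ‖y‖)
        * (‖η‖ * ‖y - η‖ ^ ((2 : ℝ) - n)) := by
  have hn' : (4 : ℝ) ≤ n := by exact_mod_cast hn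
  have hκ := greenConst_pos hn
  have hA : 0 < ‖y - η‖ := norm_pos_iff.2 (sub_ne_zero.2 hne.symm)
  have htri : ‖η‖ ≤ ‖y‖ + ‖y - η‖ := by
    have := norm_sub_le y (y - η)
    rwa [sub_sub_cancel] at this
  have h := boundary_weight_le (g := greenG n lam y η / greenConst n) (q := ((n : ℝ) - 2) / 2)
    (W := ‖y - η‖ ^ ((2 : ℝ) - n)) hA hlam hy hη htri (by linarith) (by positivity)
    (by rw [div_le_iff₀' hκ]; exact greenG_le_rpow hn hlam hy hη)
    (by rw [div_le_iff₀' hκ]; exact greenG_le_gap hn hlam hy hη hne)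
  calc (‖η‖ - lam) * greenG n lam y η
      = greenConst n * ((‖η‖ - lam) * (greenG n lam y η / greenConst n)) := by field_simp
    _ ≤ _ := mul_le_mul_of_nonneg_left h hκ.le
    _ = _ := by ring

lemma greenG_ge_of_norm_le {n : ℕ} (hn : 4 ≤ n) {lam : ℝ} (hlam : 0 < lam) {y η : Euc n}
    (hy : lam < ‖y‖) (hη : lam < ‖η‖) (hη2 : ‖η‖ ≤ 2 * lam) (hne : η ≠ y) :
    greenConst n * (((n : ℝ) - 2) / 2) * 3 ^ (-(n : ℝ))
      * ((‖y‖ - lam) * ‖y‖ ^ ((1 : ℝ) - n) / lam) * (‖η‖ - lam) ≤ greenG n lam y η := by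
  have hn' : (4 : ℝ) ≤ n := by exact_mod_cast hn
  have hκ := greenConst_pos hn
  have hy0 := hlam.trans hy
  have hA : 0 < ‖y - η‖ := norm_pos_iff.2 (sub_ne_zero.2 hne.symm)
  have hD := greenGap_nonneg hlam hy.le hη.le
  refine le_trans ?_ (greenG_ge hn hlam hy hη hne)
  have hB0 : 0 < ‖y‖ / lam * ‖invPt lam y - η‖ := by
    have h := sq_norm_invPt_sub hlam hy0 η
    have h0 : 0 ≤ ‖y‖ / lam * ‖invPt lam y - η‖ := by positivity
    rcases h0.eq_or_lt with h1 | h1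
    · rw [← h1] at h; nlinarith
    · exact h1
  have hB : ‖y‖ / lam * ‖invPt lam y - η‖ ≤ 3 * ‖y‖ := by
    have h1 : ‖invPt lam y‖ ≤ lam := by
      rw [invPt, norm_smul, Real.norm_of_nonneg (by positivity)]
      have : lam ^ 2 / ‖y‖ ^ 2 * ‖y‖ = lam * (lam / ‖y‖) := by field_simp
      rw [this]
      exact mul_le_of_le_one_right hlam.le ((div_le_one hy0).2 hy.le)
    have h2 : ‖invPt lam y - η‖ ≤ 3 * lam := by linarith [norm_sub_le (invPt lam y) η]
    calc ‖y‖ / lam * ‖invPt lam y - η‖ ≤ ‖y‖ / lam * (3 * lam) := by gcongr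
      _ = _ := by field_simp
  have hBn : 3 ^ (-(n : ℝ)) * ‖y‖ ^ (-(n : ℝ))
      ≤ (‖y‖ / lam * ‖invPt lam y - η‖) ^ (-(n : ℝ)) := by
    rw [← Real.mul_rpow (by norm_num) hy0.le]
    exact Real.rpow_le_rpow_of_nonpos hB0 hB (by linarith)
  have hgap : (‖y‖ - lam) * ‖y‖ / lam * (‖η‖ - lam) ≤ greenGap lam y η := by
    unfold greenGap
    rw [le_div_iff₀ (by positivity)]
    have h1 : (‖y‖ - lam) * ‖y‖ ≤ ‖y‖ ^ 2 - lam ^ 2 := by nlinarith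
    have h2 : (‖η‖ - lam) * lam ≤ ‖η‖ ^ 2 - lam ^ 2 := by nlinarith
    calc (‖y‖ - lam) * ‖y‖ / lam * (‖η‖ - lam) * lam ^ 2
        = (‖y‖ - lam) * ‖y‖ * ((‖η‖ - lam) * lam) := by field_simp
      _ ≤ _ := mul_le_mul h1 h2 (mul_nonneg (by linarith) hlam.le) (by nlinarith)
  have hpow : ‖y‖ ^ ((1 : ℝ) - n) = ‖y‖ ^ (-(n : ℝ)) * ‖y‖ := by
    rw [sub_eq_add_neg, add_comm, Real.rpow_add hy0, Real.rpow_one]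
  have hq : 0 ≤ ((n : ℝ) - 2) / 2 := by linarith
  have hd : 0 < ‖y‖ - lam := by linarith
  have hδ : 0 < ‖η‖ - lam := by linarith
  calc _ = greenConst n * ((((n : ℝ) - 2) / 2) * (3 ^ (-(n : ℝ)) * ‖y‖ ^ (-(n : ℝ)))
        * ((‖y‖ - lam) * ‖y‖ / lam * (‖η‖ - lam))) := by rw [hpow]; ring
    _ ≤ _ := by gcongr

lemma integrable_indicator_Ioi_norm_rpow {n : ℕ} (hn : 4 ≤ n) {r : ℝ} (hr : 0 < r) :
    Integrable (fun x : Euc n => (Ioi r).indicator (fun t : ℝ => t ^ (-(n : ℝ) - 1)) ‖x‖) ∧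
    ∫ x : Euc n, (Ioi r).indicator (fun t : ℝ => t ^ (-(n : ℝ) - 1)) ‖x‖
      = sphereArea n * r⁻¹ := by
  have : Nontrivial (Euc n) := by
    have : Nonempty (Fin n) := ⟨⟨0, by omega⟩⟩
    infer_instance
  have hcongr : ∀ y ∈ Ioi (0 : ℝ), (Ioi r).indicator (fun t : ℝ => t ^ (-2 : ℝ)) y
      = y ^ (Module.finrank ℝ (Euc n) - 1) •
        (Ioi r).indicator (fun t : ℝ => t ^ (-(n : ℝ) - 1)) y := by
    intro y hy
    rw [finrank_euclideanSpace_fin, smul_eq_mul, indicator_apply, indicator_apply]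
    split_ifs
    · rw [← Real.rpow_natCast, ← Real.rpow_add hy, Nat.cast_sub (by omega)]
      congr 1
      push_cast
      ring
    · simp
  have hinter : Ioi (0 : ℝ) ∩ Ioi r = Ioi r := by
    ext x; simp only [mem_inter_iff, mem_Ioi]; constructor <;> intro h <;> grind
  constructor
  · rw [integrable_fun_norm_addHaar, ← integrableOn_congr_fun hcongr measurableSet_Ioi]
    exact ((integrable_indicator_iff measurableSet_Ioi).2
      (integrableOn_Ioi_rpow_of_lt (by norm_num) hr)).integrableOn
  · rw [integral_fun_norm_addHaar, ← setIntegral_congr_fun measurableSet_Ioi hcongr,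
      setIntegral_indicator measurableSet_Ioi, hinter, integral_Ioi_rpow_of_lt (by norm_num) hr,
      finrank_euclideanSpace_fin, sphereArea, measureReal_def]
    norm_num [Real.rpow_neg_one]
    ring

lemma integrable_indicator_Iio_norm_rpow {n : ℕ} (hn : 4 ≤ n) {r : ℝ} (hr : 0 < r) :
    Integrable (fun x : Euc n => (Iio r).indicator (fun t : ℝ => t ^ ((2 : ℝ) - n)) ‖x‖) ∧
    ∫ x : Euc n, (Iio r).indicator (fun t : ℝ => t ^ ((2 : ℝ) - n)) ‖x‖
      = sphereArea n * (r ^ 2 / 2) := by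
  have : Nontrivial (Euc n) := by
    have : Nonempty (Fin n) := ⟨⟨0, by omega⟩⟩
    infer_instance
  have hcongr : ∀ y ∈ Ioi (0 : ℝ), (Iio r).indicator (fun t : ℝ => t) y
      = y ^ (Module.finrank ℝ (Euc n) - 1) •
        (Iio r).indicator (fun t : ℝ => t ^ ((2 : ℝ) - n)) y := by
    intro y hy
    rw [finrank_euclideanSpace_fin, smul_eq_mul, indicator_apply, indicator_apply]
    split_ifs
    · rw [← Real.rpow_natCast, ← Real.rpow_add hy, Nat.cast_sub (by omega)]
      conv_lhs => rw [← Real.rpow_one y]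
      congr 1
      push_cast
      ring
    · simp
  constructor
  · rw [integrable_fun_norm_addHaar, ← integrableOn_congr_fun hcongr measurableSet_Ioi,
      IntegrableOn, integrable_indicator_iff measurableSet_Iio, IntegrableOn,
      Measure.restrict_restrict measurableSet_Iio, Iio_inter_Ioi]
    exact (continuous_id.integrableOn_Icc (a := 0) (b := r)).mono_set Ioo_subset_Icc_self
  · rw [integral_fun_norm_addHaar, ← setIntegral_congr_fun measurableSet_Ioi hcongr,
      setIntegral_indicator measurableSet_Iio, Ioi_inter_Iio, ← integral_Ioc_eq_integral_Ioo,
      ← intervalIntegral.integral_of_le hr.le, integral_id,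
      finrank_euclideanSpace_fin, sphereArea, measureReal_def]
    norm_num
    ring

lemma riesz_tail_pointwise_le {n : ℕ} (hn : 4 ≤ n) {lam : ℝ} {y η : Euc n}
    (hy : 0 < ‖y‖) (hη : lam < ‖η‖) :
    ‖y - η‖ ^ ((2 : ℝ) - n) * ‖η‖ ^ (-(n : ℝ) - 1) ≤
      (‖y‖ / 2) ^ ((2 : ℝ) - n) * (Ioi lam).indicator (fun t : ℝ => t ^ (-(n : ℝ) - 1)) ‖η‖
      + (‖y‖ / 2) ^ (-(n : ℝ) - 1)
        * (Iio ‖y‖).indicator (fun t : ℝ => t ^ ((2 : ℝ) - n)) ‖y - η‖ := by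
  have hn' : (4 : ℝ) ≤ n := by exact_mod_cast hn
  rw [indicator_of_mem (show ‖η‖ ∈ Ioi lam from hη)]
  have hind : 0 ≤ (Iio ‖y‖).indicator (fun t : ℝ => t ^ ((2 : ℝ) - n)) ‖y - η‖ :=
    indicator_apply_nonneg fun _ => by positivity
  rcases le_or_gt (‖y‖ / 2) ‖y - η‖ with h | h
  · have h1 : ‖y - η‖ ^ ((2 : ℝ) - n) ≤ (‖y‖ / 2) ^ ((2 : ℝ) - n) :=
      Real.rpow_le_rpow_of_nonpos (by positivity) h (by linarith)
    calc _ ≤ (‖y‖ / 2) ^ ((2 : ℝ) - n) * ‖η‖ ^ (-(n : ℝ) - 1) := by gcongr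
      _ ≤ _ := le_add_of_nonneg_right (by positivity)
  · have hη2 : ‖y‖ / 2 ≤ ‖η‖ := by
      have := norm_add_le (y - η) η
      rw [sub_add_cancel] at this
      linarith
    rw [indicator_of_mem (show ‖y - η‖ ∈ Iio ‖y‖ by simp only [mem_Iio]; linarith)]
    have h1 : ‖η‖ ^ (-(n : ℝ) - 1) ≤ (‖y‖ / 2) ^ (-(n : ℝ) - 1) :=
      Real.rpow_le_rpow_of_nonpos (by positivity) hη2 (by linarith)
    calc _ ≤ ‖y - η‖ ^ ((2 : ℝ) - n) * (‖y‖ / 2) ^ (-(n : ℝ) - 1) := by gcongr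
      _ = (‖y‖ / 2) ^ (-(n : ℝ) - 1) * ‖y - η‖ ^ ((2 : ℝ) - n) := mul_comm _ _
      _ ≤ _ := le_add_of_nonneg_left (by positivity)

/-- The Riesz potential of `|η|^{-n-1}` over the exterior of a ball. -/
lemma riesz_tail_integral_le {n : ℕ} (hn : 4 ≤ n) {lam : ℝ} (hlam : 0 < lam) {y : Euc n}
    (hy : lam < ‖y‖) :
    IntegrableOn (fun η : Euc n => ‖y - η‖ ^ ((2 : ℝ) - n) * ‖η‖ ^ (-(n : ℝ) - 1))
      {η | lam < ‖η‖} ∧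
    ∫ η in {η : Euc n | lam < ‖η‖}, ‖y - η‖ ^ ((2 : ℝ) - n) * ‖η‖ ^ (-(n : ℝ) - 1)
      ≤ sphereArea n * 2 ^ ((n : ℝ) + 2) * (‖y‖ ^ ((2 : ℝ) - n) / lam) := by
  have hy0 := hlam.trans hy
  have hσ := sphereArea_pos hn
  obtain ⟨hi1, he1⟩ := integrable_indicator_Ioi_norm_rpow hn hlam
  obtain ⟨hi2, he2⟩ := integrable_indicator_Iio_norm_rpow hn hy0
  have hi1' := hi1.const_mul ((‖y‖ / 2) ^ ((2 : ℝ) - n))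
  have hi2' := (hi2.comp_sub_left y).const_mul ((‖y‖ / 2) ^ (-(n : ℝ) - 1))
  have hms : MeasurableSet {η : Euc n | lam < ‖η‖} :=
    measurableSet_lt measurable_const measurable_norm
  have hint : IntegrableOn (fun η : Euc n => ‖y - η‖ ^ ((2 : ℝ) - n) * ‖η‖ ^ (-(n : ℝ) - 1))
      {η | lam < ‖η‖} := by
    refine Integrable.mono' (hi1'.add hi2').integrableOn (by fun_prop) ?_
    filter_upwards [ae_restrict_mem hms] with η hη
    rw [Real.norm_of_nonneg (by positivity)]
    exact riesz_tail_pointwise_le hn hy0 hη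
  refine ⟨hint, ?_⟩
  have hnn : 0 ≤ᵐ[volume] fun η : Euc n =>
      (‖y‖ / 2) ^ ((2 : ℝ) - n) * (Ioi lam).indicator (fun t : ℝ => t ^ (-(n : ℝ) - 1)) ‖η‖
      + (‖y‖ / 2) ^ (-(n : ℝ) - 1)
        * (Iio ‖y‖).indicator (fun t : ℝ => t ^ ((2 : ℝ) - n)) ‖y - η‖ := by
    refine Filter.Eventually.of_forall fun η => ?_
    have h1 : 0 ≤ (Ioi lam).indicator (fun t : ℝ => t ^ (-(n : ℝ) - 1)) ‖η‖ :=
      indicator_apply_nonneg fun _ => by positivity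
    have h2 : 0 ≤ (Iio ‖y‖).indicator (fun t : ℝ => t ^ ((2 : ℝ) - n)) ‖y - η‖ :=
      indicator_apply_nonneg fun _ => by positivity
    simp only [Pi.zero_apply]
    positivity
  calc _ ≤ ∫ η in {η : Euc n | lam < ‖η‖}, _ :=
        setIntegral_mono_on hint (hi1'.add hi2').integrableOn hms
          fun η hη => riesz_tail_pointwise_le hn hy0 hη
    _ ≤ ∫ η : Euc n, _ := setIntegral_le_integral (hi1'.add hi2') hnn
    _ = (‖y‖ / 2) ^ ((2 : ℝ) - n) * (sphereArea n * lam⁻¹)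
        + (‖y‖ / 2) ^ (-(n : ℝ) - 1) * (sphereArea n * (‖y‖ ^ 2 / 2)) := by
      rw [integral_add' hi1' hi2', integral_const_mul, integral_const_mul, he1,
        integral_sub_left_eq_self
          (fun x : Euc n => (Iio ‖y‖).indicator (fun t : ℝ => t ^ ((2 : ℝ) - n)) ‖x‖), he2]
    _ = sphereArea n * ‖y‖ ^ ((2 : ℝ) - n)
        * (2 ^ ((n : ℝ) + 2) / 16 / lam + 2 ^ ((n : ℝ) + 2) / 4 / ‖y‖) := by
      rw [Real.div_rpow hy0.le (by norm_num), Real.div_rpow hy0.le (by norm_num)]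
      have e1 : (2 : ℝ) ^ ((2 : ℝ) - n) = 16 / 2 ^ ((n : ℝ) + 2) := by
        rw [show (2 : ℝ) - n = 4 - ((n : ℝ) + 2) by ring, Real.rpow_sub (by norm_num)]
        norm_num
      have e2 : (2 : ℝ) ^ (-(n : ℝ) - 1) = 2 / 2 ^ ((n : ℝ) + 2) := by
        rw [show -(n : ℝ) - 1 = 1 - ((n : ℝ) + 2) by ring, Real.rpow_sub (by norm_num)]
        norm_num
      have e3 : ‖y‖ ^ (-(n : ℝ) - 1) = ‖y‖ ^ ((2 : ℝ) - n) / ‖y‖ ^ 3 := by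
        rw [show -(n : ℝ) - 1 = (2 - (n : ℝ)) - (3 : ℕ) by push_cast; ring,
          Real.rpow_sub_natCast hy0.ne']
      have h2 : (0 : ℝ) < 2 ^ ((n : ℝ) + 2) := by positivity
      rw [e1, e2, e3]
      field_simp
      ring
    _ ≤ sphereArea n * ‖y‖ ^ ((2 : ℝ) - n)
        * (2 ^ ((n : ℝ) + 2) / 16 / lam + 2 ^ ((n : ℝ) + 2) / 4 / lam) := by gcongr
    _ = sphereArea n * 2 ^ ((n : ℝ) + 2) * (‖y‖ ^ ((2 : ℝ) - n) / lam) * (5 / 16) := by ring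
    _ ≤ _ := mul_le_of_le_one_right (by positivity) (by norm_num)

/-- The point `λe` on the first coordinate axis. -/
def axisPt (n : ℕ) (h0 : 0 < n) (lam : ℝ) : Euc n :=
  lam • EuclideanSpace.single (⟨0, h0⟩ : Fin n) (1 : ℝ)

/-- Centre of a ball of radius `r` inside the cone region with apex `λe`. -/
def coneCenter (n : ℕ) (h0 : 0 < n) (lam r : ℝ) : Euc n :=
  axisPt n h0 lam + r • (axisPt n h0 4 + EuclideanSpace.single (lastIdx n h0) (1 : ℝ))

lemma zero_ne_lastIdx {n : ℕ} (hn : 4 ≤ n) (h0 : 0 < n) : (⟨0, h0⟩ : Fin n) ≠ lastIdx n h0 := by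
  rw [lastIdx, ne_eq, Fin.mk.injEq]
  omega

lemma coneCenter_ball_bounds {n : ℕ} (hn : 4 ≤ n) (h0 : 0 < n) {lam r : ℝ} (hr : 0 < r)
    {η : Euc n} (hη : η ∈ ball (coneCenter n h0 lam r) r) :
    lam + 3 * r < η ⟨0, h0⟩ ∧ η ⟨0, h0⟩ < lam + 5 * r ∧ 0 < η (lastIdx n h0) ∧
      ‖η - axisPt n h0 lam‖ ≤ 6 * r := by
  have hne := zero_ne_lastIdx hn h0
  rw [mem_ball_iff_norm] at hη
  have h1 := (PiLp.norm_apply_le (η - coneCenter n h0 lam r) ⟨0, h0⟩).trans_lt hη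
  have h2 := (PiLp.norm_apply_le (η - coneCenter n h0 lam r) (lastIdx n h0)).trans_lt hη
  have e1 : (η - coneCenter n h0 lam r) ⟨0, h0⟩ = η ⟨0, h0⟩ - (lam + r * 4) := by
    simp [coneCenter, axisPt, hne]
  have e2 : (η - coneCenter n h0 lam r) (lastIdx n h0) = η (lastIdx n h0) - r := by
    simp [coneCenter, axisPt, hne.symm]
  rw [e1, Real.norm_eq_abs, abs_lt] at h1
  rw [e2, Real.norm_eq_abs, abs_lt] at h2
  refine ⟨by linarith, by linarith, by linarith, ?_⟩
  have h3 : ‖axisPt n h0 4 + EuclideanSpace.single (lastIdx n h0) (1 : ℝ)‖ ≤ 5 := by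
    refine (norm_add_le _ _).trans ?_
    rw [axisPt, norm_smul]
    norm_num
  have h4 : η - axisPt n h0 lam = (η - coneCenter n h0 lam r)
      + r • (axisPt n h0 4 + EuclideanSpace.single (lastIdx n h0) (1 : ℝ)) := by
    rw [coneCenter]; abel
  rw [h4]
  refine (norm_add_le _ _).trans ?_
  rw [norm_smul, Real.norm_of_nonneg hr.le]
  nlinarith

lemma tailNorm_le_norm_sub_axisPt {n : ℕ} (h0 : 0 < n) (lam : ℝ) (η : Euc n) :
    tailNorm n h0 η ≤ ‖η - axisPt n h0 lam‖ := by
  rw [tailNorm, EuclideanSpace.norm_eq]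
  refine Real.sqrt_le_sqrt ?_
  calc ∑ i ∈ Finset.univ.erase (⟨0, h0⟩ : Fin n), η i ^ 2
      = ∑ i ∈ Finset.univ.erase (⟨0, h0⟩ : Fin n), ‖(η - axisPt n h0 lam) i‖ ^ 2 := by
        refine Finset.sum_congr rfl fun i hi => ?_
        have : i ≠ ⟨0, h0⟩ := (Finset.mem_erase.1 hi).1
        simp [axisPt, this]
    _ ≤ _ := Finset.sum_le_sum_of_subset_of_nonneg (Finset.erase_subset _ _)
        fun _ _ _ => by positivity

lemma norm_axisPt {n : ℕ} (h0 : 0 < n) {lam : ℝ} (hlam : 0 ≤ lam) : ‖axisPt n h0 lam‖ = lam := by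
  simp [axisPt, norm_smul, abs_of_nonneg hlam]

lemma apply_le_norm {n : ℕ} (η : Euc n) (i : Fin n) : η i ≤ ‖η‖ :=
  (le_abs_self _).trans (PiLp.norm_apply_le η i)

lemma coneCenter_ball_subset {n : ℕ} (hn : 4 ≤ n) (h0 : 0 < n) {lam ρ r : ℝ} (hr : 0 < r)
    (hrl : 24 * r ≤ lam) (hρ : 4 * lam ≤ ρ) :
    ball (coneCenter n h0 lam r) r ⊆ OmegaSet n h0 lam ρ := by
  intro η hη
  obtain ⟨h1, -, h3, h4⟩ := coneCenter_ball_bounds hn h0 hr hη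
  have h5 : ‖η‖ ≤ lam + 6 * r := by
    calc ‖η‖ = ‖axisPt n h0 lam + (η - axisPt n h0 lam)‖ := by rw [add_sub_cancel]
      _ ≤ ‖axisPt n h0 lam‖ + ‖η - axisPt n h0 lam‖ := norm_add_le _ _
      _ ≤ _ := by rw [norm_axisPt h0 (by linarith)]; linarith
  have h6 := apply_le_norm η ⟨0, h0⟩
  have h7 := tailNorm_le_norm_sub_axisPt h0 lam η
  refine ⟨⟨⟨?_, h3⟩, ?_⟩, ?_, ?_⟩
  · rw [mem_ball_zero_iff]; linarith
  · rw [mem_closedBall_zero_iff]; linarith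
  · linarith
  · linarith

/-- Squared distance to the sphere times the model weight centred at `λe`. -/
def coneWeight (n : ℕ) (h0 : 0 < n) (lam : ℝ) (η : Euc n) : ℝ :=
  (‖η‖ - lam) ^ 2 * (1 + ‖η - axisPt n h0 lam‖ ^ 2) ^ (-(((n : ℝ) + 2) / 2))

lemma coneWeight_nonneg {n : ℕ} (h0 : 0 < n) (lam : ℝ) (η : Euc n) :
    0 ≤ coneWeight n h0 lam η := by
  unfold coneWeight; positivity

lemma continuous_coneWeight {n : ℕ} (h0 : 0 < n) (lam : ℝ) :
    Continuous (coneWeight n h0 lam) := by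
  unfold coneWeight
  refine Continuous.mul (by fun_prop) (Continuous.rpow_const (by fun_prop) fun η => Or.inl ?_)
  positivity

lemma integrableOn_coneWeight {n : ℕ} (h0 : 0 < n) (lam ρ : ℝ) :
    IntegrableOn (coneWeight n h0 lam) (OmegaSet n h0 lam ρ) := by
  refine ((continuous_coneWeight h0 lam).continuousOn.integrableOn_compact
    (isCompact_closedBall (0 : Euc n) (2 * lam))).mono_set fun η hη => ?_
  rw [mem_closedBall_zero_iff]
  exact hη.2.1

lemma coneWeight_ge {n : ℕ} (hn : 4 ≤ n) (h0 : 0 < n) {lam r : ℝ} (hr : 1 ≤ r)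
    {η : Euc n} (hη : η ∈ ball (coneCenter n h0 lam r) r) :
    9 * 37 ^ (-(((n : ℝ) + 2) / 2)) * r ^ (-(n : ℝ)) ≤ coneWeight n h0 lam η := by
  have hr0 : 0 < r := by linarith
  obtain ⟨h1, -, -, h4⟩ := coneCenter_ball_bounds hn h0 hr0 hη
  have h6 := apply_le_norm η ⟨0, h0⟩
  have h7 : (37 * r ^ 2) ^ (-(((n : ℝ) + 2) / 2))
      ≤ (1 + ‖η - axisPt n h0 lam‖ ^ 2) ^ (-(((n : ℝ) + 2) / 2)) := by
    have hn0 : (0 : ℝ) ≤ n := n.cast_nonneg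
    refine Real.rpow_le_rpow_of_nonpos (by positivity) ?_ (by linarith)
    nlinarith [norm_nonneg (η - axisPt n h0 lam)]
  have h8 : (37 * r ^ 2) ^ (-(((n : ℝ) + 2) / 2))
      = 37 ^ (-(((n : ℝ) + 2) / 2)) * (r ^ (-(n : ℝ)) / r ^ 2) := by
    rw [Real.mul_rpow (by norm_num) (by positivity), ← Real.rpow_natCast_mul hr0.le,
      ← Real.rpow_sub_natCast hr0.ne']
    congr 2
    push_cast
    ring
  calc 9 * 37 ^ (-(((n : ℝ) + 2) / 2)) * r ^ (-(n : ℝ))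
      = (3 * r) ^ 2 * (37 * r ^ 2) ^ (-(((n : ℝ) + 2) / 2)) := by
        rw [h8]; field_simp; ring
    _ ≤ _ := by
        unfold coneWeight
        gcongr
        linarith

lemma coneWeight_ball_integral_ge {n : ℕ} (hn : 4 ≤ n) (h0 : 0 < n) {lam r : ℝ} (hr : 1 ≤ r) :
    9 * 37 ^ (-(((n : ℝ) + 2) / 2)) * volume.real (ball (0 : Euc n) 1)
      ≤ ∫ η in ball (coneCenter n h0 lam r) r, coneWeight n h0 lam η := by
  have hr0 : 0 < r := by linarith
  have h := setIntegral_ge_of_const_le_real (μ := volume) (f := coneWeight n h0 lam)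
    (measurableSet_ball (x := coneCenter n h0 lam r) (ε := r)) measure_ball_lt_top.ne
    (fun η hη => coneWeight_ge hn h0 hr hη)
    (((continuous_coneWeight h0 lam).continuousOn.integrableOn_compact
      (isCompact_closedBall _ _)).mono_set ball_subset_closedBall)
  refine le_trans (le_of_eq ?_) h
  rw [measureReal_def, measureReal_def, Measure.addHaar_ball_of_pos _ _ hr0, ENNReal.toReal_mul,
    ENNReal.toReal_ofReal (by positivity), finrank_euclideanSpace_fin, Real.rpow_neg hr0.le,
    Real.rpow_natCast]
  field_simp

lemma pairwise_disjoint_coneCenter_ball {n : ℕ} (hn : 4 ≤ n) (h0 : 0 < n) (lam : ℝ) :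
    Pairwise (Function.onFun Disjoint fun k : ℕ => ball (coneCenter n h0 lam (2 ^ k)) (2 ^ k)) := by
  refine (pairwise_disjoint_on _).2 fun k l hkl => ?_
  refine Set.disjoint_left.2 fun η hk hl => ?_
  obtain ⟨-, h1, -, -⟩ := coneCenter_ball_bounds hn h0 (by positivity) hk
  obtain ⟨h2, -, -, -⟩ := coneCenter_ball_bounds hn h0 (by positivity) hl
  have h3 : (2 : ℝ) ^ (k + 1) ≤ 2 ^ l := pow_le_pow_right₀ (by norm_num) hkl
  have h4 : (0 : ℝ) < 2 ^ k := by positivity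
  rw [pow_succ] at h3
  linarith

lemma integral_coneWeight_ge {n : ℕ} (hn : 4 ≤ n) (h0 : 0 < n) {lam ρ : ℝ} (hlam : 576 ≤ lam)
    (hρ : 4 * lam ≤ ρ) :
    9 * 37 ^ (-(((n : ℝ) + 2) / 2)) * volume.real (ball (0 : Euc n) 1) / 2 * Real.log lam
      ≤ ∫ η in OmegaSet n h0 lam ρ, coneWeight n h0 lam η := by
  have hlam0 : 0 < lam := by linarith
  set N : ℕ := ⌊Real.log lam / 2⌋₊ with hN
  have hlog : 0 ≤ Real.log lam := Real.log_nonneg (by linarith)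
  have hpow : ∀ k ∈ Finset.range (N + 1), 24 * (2 : ℝ) ^ k ≤ lam := by
    intro k hk
    have h1 : (k : ℝ) ≤ Real.log lam / 2 :=
      (Nat.le_floor_iff (by positivity)).1 (Nat.lt_succ_iff.1 (Finset.mem_range.1 hk))
    have h2 : (2 : ℝ) ^ k ≤ Real.exp (Real.log lam / 2) := by
      calc (2 : ℝ) ^ k ≤ Real.exp 1 ^ k :=
            pow_le_pow_left₀ (by norm_num) (by linarith [Real.add_one_le_exp (1 : ℝ)]) _
        _ = Real.exp k := by rw [← Real.exp_nat_mul, mul_one]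
        _ ≤ _ := Real.exp_le_exp.2 h1
    have h3 : Real.exp (Real.log lam / 2) ^ 2 = lam := by
      rw [← Real.exp_nat_mul]
      push_cast
      rw [mul_div_cancel₀ _ (by norm_num), Real.exp_log hlam0]
    nlinarith [Real.exp_pos (Real.log lam / 2)]
  have hsub : (⋃ k ∈ Finset.range (N + 1), ball (coneCenter n h0 lam (2 ^ k)) (2 ^ k))
      ⊆ OmegaSet n h0 lam ρ :=
    iUnion₂_subset fun k hk => coneCenter_ball_subset hn h0 (by positivity) (hpow k hk) hρ
  have hF := integrableOn_coneWeight h0 lam ρ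
  calc _ ≤ ((N + 1 : ℕ) : ℝ)
          * (9 * 37 ^ (-(((n : ℝ) + 2) / 2)) * volume.real (ball (0 : Euc n) 1)) := by
        have h1 : Real.log lam / 2 ≤ ((N + 1 : ℕ) : ℝ) := by
          push_cast
          exact (Nat.lt_floor_add_one _).le
        have h2 : 0 ≤ 9 * (37 : ℝ) ^ (-(((n : ℝ) + 2) / 2)) * volume.real (ball (0 : Euc n) 1) := by
          positivity
        nlinarith
    _ ≤ ∑ k ∈ Finset.range (N + 1), ∫ η in ball (coneCenter n h0 lam (2 ^ k)) (2 ^ k),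
          coneWeight n h0 lam η := by
        refine le_trans (le_of_eq ?_) (Finset.card_nsmul_le_sum _ _ _ fun k _ =>
          coneWeight_ball_integral_ge hn h0 (one_le_pow₀ (by norm_num)))
        rw [Finset.card_range, nsmul_eq_mul]
    _ = ∫ η in ⋃ k ∈ Finset.range (N + 1), ball (coneCenter n h0 lam (2 ^ k)) (2 ^ k),
          coneWeight n h0 lam η :=
        (integral_biUnion_finset _ (fun _ _ => measurableSet_ball)
          ((pairwise_disjoint_coneCenter_ball hn h0 lam).set_pairwise _)
          fun k hk => hF.mono_set
            (coneCenter_ball_subset hn h0 (by positivity) (hpow k hk) hρ)).symm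
    _ ≤ _ := setIntegral_mono_set hF
        (Filter.Eventually.of_forall fun η => coneWeight_nonneg h0 lam η) hsub.eventuallyLE

lemma integrableOn_greenG_mul_weight {n : ℕ} (hn : 4 ≤ n) {lam : ℝ} (hlam : 0 < lam) {z : Euc n}
    (hz : lam < ‖z‖) :
    IntegrableOn (fun η => greenG n lam z η * ((‖η‖ - lam) * ‖η‖ ^ (-(n : ℝ) - 2)))
      {η | lam < ‖η‖} ∧
    ∫ η in {η : Euc n | lam < ‖η‖}, greenG n lam z η * ((‖η‖ - lam) * ‖η‖ ^ (-(n : ℝ) - 2))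
      ≤ greenConst n * (8 + 256 * (((n : ℝ) - 2) / 2)) * (sphereArea n * 2 ^ ((n : ℝ) + 2))
        * ((‖z‖ - lam) * ‖z‖ ^ ((1 : ℝ) - n) / lam) := by
  have hn' : (4 : ℝ) ≤ n := by exact_mod_cast hn
  have hz0 := hlam.trans hz
  have hd : 0 < ‖z‖ - lam := by linarith
  have hκ := greenConst_pos hn
  have hq : 0 ≤ ((n : ℝ) - 2) / 2 := by linarith
  obtain ⟨hJ, hJle⟩ := riesz_tail_integral_le hn hlam hz
  set K : ℝ := greenConst n * (8 + 256 * (((n : ℝ) - 2) / 2)) * ((‖z‖ - lam) / ‖z‖) with hK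
  have hK0 : 0 ≤ K := by positivity
  have hms : MeasurableSet {η : Euc n | lam < ‖η‖} :=
    measurableSet_lt measurable_const measurable_norm
  have hpt : ∀ η : Euc n, lam < ‖η‖ → η ≠ z →
      greenG n lam z η * ((‖η‖ - lam) * ‖η‖ ^ (-(n : ℝ) - 2))
        ≤ K * (‖z - η‖ ^ ((2 : ℝ) - n) * ‖η‖ ^ (-(n : ℝ) - 1)) := by
    intro η hη hne
    have hη0 := hlam.trans hη
    have e : ‖η‖ ^ (-(n : ℝ) - 1) = ‖η‖ * ‖η‖ ^ (-(n : ℝ) - 2) := by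
      rw [show -(n : ℝ) - 1 = 1 + (-(n : ℝ) - 2) by ring, Real.rpow_add hη0, Real.rpow_one]
    calc _ = (‖η‖ - lam) * greenG n lam z η * ‖η‖ ^ (-(n : ℝ) - 2) := by ring
      _ ≤ K * (‖η‖ * ‖z - η‖ ^ ((2 : ℝ) - n)) * ‖η‖ ^ (-(n : ℝ) - 2) := by
        exact mul_le_mul_of_nonneg_right (dist_mul_greenG_le hn hlam hz hη hne) (by positivity)
      _ = _ := by rw [e]; ring
  have hae : ∀ᵐ η : Euc n, η ≠ z := by
    have : Nontrivial (Euc n) := by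
      have : Nonempty (Fin n) := ⟨⟨0, by omega⟩⟩
      infer_instance
    exact Measure.ae_ne volume z
  have hint : IntegrableOn (fun η => greenG n lam z η * ((‖η‖ - lam) * ‖η‖ ^ (-(n : ℝ) - 2)))
      {η | lam < ‖η‖} := by
    refine Integrable.mono' (hJ.const_mul K) ?_ ?_
    · unfold greenG
      fun_prop
    · filter_upwards [ae_restrict_mem hms, ae_restrict_of_ae hae] with η hη hne
      have hη' : 0 ≤ ‖η‖ - lam := by
        have : lam < ‖η‖ := hη
        linarith
      rw [Real.norm_of_nonneg (mul_nonneg (greenG_nonneg hn hlam hz hη hne) (by positivity))]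
      exact hpt η hη hne
  refine ⟨hint, ?_⟩
  have hpow : ‖z‖ ^ ((2 : ℝ) - n) = ‖z‖ ^ ((1 : ℝ) - n) * ‖z‖ := by
    rw [show (2 : ℝ) - n = (1 - n) + 1 by ring, Real.rpow_add hz0, Real.rpow_one]
  calc _ ≤ ∫ η in {η : Euc n | lam < ‖η‖},
        K * (‖z - η‖ ^ ((2 : ℝ) - n) * ‖η‖ ^ (-(n : ℝ) - 1)) := by
        refine setIntegral_mono_on_ae hint (hJ.const_mul K) hms ?_
        filter_upwards [hae] with η hne hη using hpt η hη hne
    _ = K * ∫ η in {η : Euc n | lam < ‖η‖},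
        ‖z - η‖ ^ ((2 : ℝ) - n) * ‖η‖ ^ (-(n : ℝ) - 1) := integral_const_mul _ _
    _ ≤ K * (sphereArea n * 2 ^ ((n : ℝ) + 2) * (‖z‖ ^ ((2 : ℝ) - n) / lam)) := by gcongr
    _ = _ := by
      rw [hK, hpow]
      field_simp

lemma measurableSet_SigSet {n : ℕ} (h0 : 0 < n) (lam ρ : ℝ) :
    MeasurableSet (SigSet n h0 lam ρ) := by
  have h : IsOpen (upperHalf n h0) := isOpen_lt continuous_const (by fun_prop)
  exact (measurableSet_ball.inter h.measurableSet).diff measurableSet_closedBall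

lemma measurableSet_OmegaSet {n : ℕ} (h0 : 0 < n) (lam ρ : ℝ) :
    MeasurableSet (OmegaSet n h0 lam ρ) := by
  have h : Continuous (tailNorm n h0) := by
    unfold tailNorm
    fun_prop
  have hcone : IsOpen {η : Euc n | 2 * tailNorm n h0 η < η (⟨0, h0⟩ : Fin n)} :=
    isOpen_lt (continuous_const.mul h) (by fun_prop)
  exact (measurableSet_SigSet h0 lam ρ).inter
    ((measurableSet_le measurable_norm measurable_const).inter hcone.measurableSet)

lemma lt_norm_of_mem_SigSet {n : ℕ} {h0 : 0 < n} {lam ρ : ℝ} {η : Euc n}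
    (hη : η ∈ SigSet n h0 lam ρ) : lam < ‖η‖ := by
  simpa using hη.2

lemma abs_source_le {n : ℕ} {h0 : 0 < n} {a lam ρ : ℝ} (ha : 0 < a) (hlam : 1 ≤ lam)
    {Q : Euc n → ℝ}
    (hQ1 : ∀ η ∈ OmegaSet n h0 lam ρ, |Q η| ≤ a * (‖η‖ - lam))
    (hQ2 : ∀ η ∈ SigSet n h0 lam ρ \ OmegaSet n h0 lam ρ,
      |Q η| ≤ a * (‖η‖ - lam) * ‖η‖ ^ (-(n : ℝ) - 2))
    {η : Euc n} (hη : η ∈ SigSet n h0 lam ρ) :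
    |Q η| ≤ a * (2 * lam) ^ ((n : ℝ) + 2) * ((‖η‖ - lam) * ‖η‖ ^ (-(n : ℝ) - 2)) := by
  have hlt := lt_norm_of_mem_SigSet hη
  have hη0 : 0 < ‖η‖ := by linarith
  have hδ : 0 < ‖η‖ - lam := by linarith
  have hn0 : (0 : ℝ) ≤ n := n.cast_nonneg
  by_cases hΩ : η ∈ OmegaSet n h0 lam ρ
  · have h1 : (2 * lam) ^ (-(n : ℝ) - 2) ≤ ‖η‖ ^ (-(n : ℝ) - 2) :=
      Real.rpow_le_rpow_of_nonpos hη0 hΩ.2.1 (by linarith)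
    have h2 : (2 * lam) ^ ((n : ℝ) + 2) * (2 * lam) ^ (-(n : ℝ) - 2) = 1 := by
      rw [← Real.rpow_add (by linarith)]
      simp
    calc |Q η| ≤ a * (‖η‖ - lam) := hQ1 η hΩ
      _ = a * (2 * lam) ^ ((n : ℝ) + 2) * ((‖η‖ - lam) * (2 * lam) ^ (-(n : ℝ) - 2)) := by
        linear_combination (-a * (‖η‖ - lam)) * h2
      _ ≤ _ := by gcongr
  · have h1 : 1 ≤ (2 * lam) ^ ((n : ℝ) + 2) :=
      Real.one_le_rpow (by linarith) (by linarith)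
    calc |Q η| ≤ a * 1 * ((‖η‖ - lam) * ‖η‖ ^ (-(n : ℝ) - 2)) := by
          have := hQ2 η ⟨hη, hΩ⟩
          linarith
      _ ≤ _ := by gcongr

/-- Integrability and two-sided control of the potential with the unreflected Green's function. -/
lemma green_potential_bounds {n : ℕ} (hn : 4 ≤ n) (h0 : 0 < n) {a₁ a₂ : ℝ} (ha₁ : 0 < a₁)
    (ha₂ : 0 < a₂) :
    ∃ R₀ : ℝ, 8 ≤ R₀ ∧ ∃ c : ℝ, 0 < c ∧ ∃ C : ℝ, 0 < C ∧ ∀ lam : ℝ, R₀ ≤ lam →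
      ∀ γ : ℝ, 0 < γ → ∀ ρ : ℝ, 4 * lam ≤ ρ → ∀ Q : Euc n → ℝ,
        ContinuousOn Q (SigSet n h0 lam ρ) →
        (∀ η ∈ OmegaSet n h0 lam ρ, Q η ≤ -a₁ * γ * (‖η‖ - lam)
            * (1 + ‖η - axisPt n h0 lam‖ ^ 2) ^ (-(((n : ℝ) + 2) / 2))) →
        (∀ η ∈ OmegaSet n h0 lam ρ, |Q η| ≤ a₂ * γ * (‖η‖ - lam)) →
        (∀ η ∈ SigSet n h0 lam ρ \ OmegaSet n h0 lam ρ,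
          |Q η| ≤ a₂ * γ * (‖η‖ - lam) * ‖η‖ ^ (-(n : ℝ) - 2)) →
        ∀ z : Euc n, lam < ‖z‖ →
          IntegrableOn (fun η => greenG n lam z η * Q η) (SigSet n h0 lam ρ) ∧
          (∫ η in SigSet n h0 lam ρ, greenG n lam z η * Q η)
            ≤ -(c * γ * ((‖z‖ - lam) * ‖z‖ ^ ((1 : ℝ) - n) / lam) * Real.log lam) ∧
          |∫ η in SigSet n h0 lam ρ, greenG n lam z η * Q η|
            ≤ C * γ * lam ^ ((n : ℝ) + 2) * ((‖z‖ - lam) * ‖z‖ ^ ((1 : ℝ) - n) / lam) := by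
  have hn' : (4 : ℝ) ≤ n := by exact_mod_cast hn
  have hκ := greenConst_pos hn
  have hσ := sphereArea_pos hn
  have hq : 0 < ((n : ℝ) - 2) / 2 := by linarith
  obtain ⟨C₃, hC₃⟩ : ∃ x : ℝ, x = greenConst n * (8 + 256 * (((n : ℝ) - 2) / 2))
    * (sphereArea n * 2 ^ ((n : ℝ) + 2)) := ⟨_, rfl⟩
  obtain ⟨c₁, hc₁⟩ : ∃ x : ℝ, x = greenConst n * (((n : ℝ) - 2) / 2) * 3 ^ (-(n : ℝ)) := ⟨_, rfl⟩
  obtain ⟨c₀, hc₀⟩ : ∃ x : ℝ, x =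
    9 * (37 : ℝ) ^ (-(((n : ℝ) + 2) / 2)) * volume.real (ball (0 : Euc n) 1) / 2 := ⟨_, rfl⟩
  have hC₃0 : 0 < C₃ := by rw [hC₃]; positivity
  have hc₁0 : 0 < c₁ := by rw [hc₁]; positivity
  have hc₀0 : 0 < c₀ := by
    have hv : 0 < volume.real (ball (0 : Euc n) 1) :=
      ENNReal.toReal_pos (Metric.measure_ball_pos _ _ one_pos).ne' measure_ball_lt_top.ne
    rw [hc₀]; positivity
  refine ⟨max 576 (Real.exp (2 * (a₂ * C₃) / (a₁ * c₁ * c₀))),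
    le_trans (by norm_num) (le_max_left _ _), a₁ * c₁ * c₀ / 2, by positivity,
    a₂ * 2 ^ ((n : ℝ) + 2) * C₃, by positivity, ?_⟩
  intro lam hlamR γ hγ ρ hρ Q hQc hQ1 hQ2 hQ3 z hz
  have hlam576 : 576 ≤ lam := (le_max_left _ _).trans hlamR
  have hlam0 : 0 < lam := by linarith
  have hlog : 2 * (a₂ * C₃) ≤ a₁ * c₁ * c₀ * Real.log lam := by
    have h1 := (Real.le_log_iff_exp_le hlam0).2 ((le_max_right _ _).trans hlamR)
    rwa [div_le_iff₀' (by positivity)] at h1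
  have hd : 0 < ‖z‖ - lam := by linarith
  have hz0 := hlam0.trans hz
  obtain ⟨hI, hIle⟩ := integrableOn_greenG_mul_weight hn hlam0 hz
  have hCone := integral_coneWeight_ge hn h0 hlam576 hρ
  rw [← hC₃] at hIle
  rw [← hc₀] at hCone
  set M : ℝ := (‖z‖ - lam) * ‖z‖ ^ ((1 : ℝ) - n) / lam with hM
  have hM0 : 0 ≤ M := by positivity
  set S := SigSet n h0 lam ρ
  set Ω := OmegaSet n h0 lam ρ
  have hSm : MeasurableSet S := measurableSet_SigSet h0 lam ρ
  have hΩm : MeasurableSet Ω := measurableSet_OmegaSet h0 lam ρ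
  have hΩS : Ω ⊆ S := fun η hη => hη.1
  have hSext : S ⊆ {η : Euc n | lam < ‖η‖} := fun η hη => lt_norm_of_mem_SigSet hη
  have hms : MeasurableSet {η : Euc n | lam < ‖η‖} :=
    measurableSet_lt measurable_const measurable_norm
  have hae : ∀ᵐ η : Euc n, η ≠ z := by
    have : Nontrivial (Euc n) := by
      have : Nonempty (Fin n) := ⟨⟨0, by omega⟩⟩
      infer_instance
    exact Measure.ae_ne volume z
  set W : Euc n → ℝ :=
    fun η => greenG n lam z η * ((‖η‖ - lam) * ‖η‖ ^ (-(n : ℝ) - 2)) with hW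
  have hWnn : 0 ≤ᵐ[volume.restrict {η : Euc n | lam < ‖η‖}] W := by
    filter_upwards [ae_restrict_mem hms, ae_restrict_of_ae hae] with η hη hne
    have hη' : 0 ≤ ‖η‖ - lam := by
      have : lam < ‖η‖ := hη
      linarith
    exact mul_nonneg (greenG_nonneg hn hlam0 hz hη hne) (by positivity)
  have hWle : ∀ T ⊆ S, ∫ η in T, W η ≤ C₃ * M := fun T hT =>
    (setIntegral_mono_set hI hWnn (hT.trans hSext).eventuallyLE).trans hIle
  have hbound : ∀ᵐ η ∂volume.restrict S, ‖greenG n lam z η * Q η‖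
      ≤ a₂ * γ * (2 * lam) ^ ((n : ℝ) + 2) * W η := by
    filter_upwards [ae_restrict_mem hSm, ae_restrict_of_ae hae] with η hη hne
    have hG := greenG_nonneg hn hlam0 hz (hSext hη) hne
    have hQη := abs_source_le (a := a₂ * γ) (by positivity) (by linarith) hQ2 hQ3 hη
    rw [norm_mul, Real.norm_of_nonneg hG, Real.norm_eq_abs]
    calc _ ≤ greenG n lam z η * (a₂ * γ * (2 * lam) ^ ((n : ℝ) + 2)
          * ((‖η‖ - lam) * ‖η‖ ^ (-(n : ℝ) - 2))) := by gcongr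
      _ = _ := by rw [hW]; ring
  have hint : IntegrableOn (fun η => greenG n lam z η * Q η) S := by
    refine Integrable.mono' ((hI.mono_set hSext).const_mul _) ?_ hbound
    refine AEStronglyMeasurable.mul ?_ (hQc.aestronglyMeasurable hSm)
    unfold greenG
    fun_prop
  refine ⟨hint, ?_, ?_⟩
  · have hsplit : ∫ η in S, greenG n lam z η * Q η
        = (∫ η in Ω, greenG n lam z η * Q η) + ∫ η in S \ Ω, greenG n lam z η * Q η := by
      rw [setIntegral_sdiff hΩm hint hΩS]
      ring
    have hout : ∫ η in S \ Ω, greenG n lam z η * Q η ≤ a₂ * γ * (C₃ * M) := by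
      calc _ ≤ ∫ η in S \ Ω, a₂ * γ * W η := by
            refine setIntegral_mono_on_ae (hint.mono_set sdiff_subset)
              ((hI.mono_set (sdiff_subset.trans hSext)).const_mul _) (hSm.diff hΩm) ?_
            filter_upwards [hae] with η hne hη
            have hG := greenG_nonneg hn hlam0 hz (hSext hη.1) hne
            have h1 := (le_abs_self _).trans (hQ3 η hη)
            calc _ ≤ greenG n lam z η
                  * (a₂ * γ * (‖η‖ - lam) * ‖η‖ ^ (-(n : ℝ) - 2)) := by gcongr
              _ = _ := by rw [hW]; ring
        _ = a₂ * γ * ∫ η in S \ Ω, W η := integral_const_mul _ _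
        _ ≤ _ := by
          gcongr
          exact hWle _ sdiff_subset
    have hin : ∫ η in Ω, greenG n lam z η * Q η ≤ -(a₁ * γ * (c₁ * M)) * (c₀ * Real.log lam) := by
      calc _ ≤ ∫ η in Ω, -(a₁ * γ * (c₁ * M)) * coneWeight n h0 lam η := by
            refine setIntegral_mono_on_ae (hint.mono_set hΩS)
              ((integrableOn_coneWeight h0 lam ρ).const_mul _) hΩm ?_
            filter_upwards [hae] with η hne hη
            have hη1 : lam < ‖η‖ := hSext (hΩS hη)
            have hδ : 0 < ‖η‖ - lam := by linarith
            have hG := greenG_nonneg hn hlam0 hz hη1 hne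
            have hG1 := greenG_ge_of_norm_le hn hlam0 hz hη1 hη.2.1 hne
            rw [← hc₁, ← hM] at hG1
            have hX : 0 ≤ (1 + ‖η - axisPt n h0 lam‖ ^ 2) ^ (-(((n : ℝ) + 2) / 2)) := by
              positivity
            calc greenG n lam z η * Q η
                ≤ greenG n lam z η * (-a₁ * γ * (‖η‖ - lam)
                  * (1 + ‖η - axisPt n h0 lam‖ ^ 2) ^ (-(((n : ℝ) + 2) / 2))) :=
                  mul_le_mul_of_nonneg_left (hQ1 η hη) hG
              _ = -(greenG n lam z η * (a₁ * γ * (‖η‖ - lam)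
                  * (1 + ‖η - axisPt n h0 lam‖ ^ 2) ^ (-(((n : ℝ) + 2) / 2)))) := by ring
              _ ≤ -(c₁ * M * (‖η‖ - lam) * (a₁ * γ * (‖η‖ - lam)
                  * (1 + ‖η - axisPt n h0 lam‖ ^ 2) ^ (-(((n : ℝ) + 2) / 2)))) :=
                  neg_le_neg (mul_le_mul_of_nonneg_right hG1 (by positivity))
              _ = _ := by rw [coneWeight]; ring
        _ = -(a₁ * γ * (c₁ * M)) * ∫ η in Ω, coneWeight n h0 lam η := integral_const_mul _ _
        _ ≤ _ := mul_le_mul_of_nonpos_left hCone (neg_nonpos.2 (by positivity))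
    rw [hsplit]
    have hγM : 0 ≤ γ * M := by positivity
    nlinarith [mul_le_mul_of_nonneg_left hlog hγM]
  · calc |∫ η in S, greenG n lam z η * Q η|
        ≤ ∫ η in S, a₂ * γ * (2 * lam) ^ ((n : ℝ) + 2) * W η :=
          norm_integral_le_of_norm_le ((hI.mono_set hSext).const_mul _) hbound
      _ = a₂ * γ * (2 * lam) ^ ((n : ℝ) + 2) * ∫ η in S, W η := integral_const_mul _ _
      _ ≤ a₂ * γ * (2 * lam) ^ ((n : ℝ) + 2) * (C₃ * M) := by
        gcongr
        exact hWle _ subset_rfl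
      _ = _ := by
        rw [Real.mul_rpow (by norm_num) hlam0.le]
        ring

lemma norm_reflPt {n : ℕ} (h0 : 0 < n) (y : Euc n) : ‖reflPt n h0 y‖ = ‖y‖ := by
  rw [← sq_eq_sq₀ (norm_nonneg _) (norm_nonneg _), reflPt, norm_sub_sq_real, norm_smul,
    inner_smul_right, EuclideanSpace.inner_single_right, PiLp.norm_single]
  simp only [norm_one, mul_one, conj_trivial, Real.norm_eq_abs, sq_abs, one_mul]
  ring

lemma profile_bounds_near {n : ℕ} (hn : 4 ≤ n) {lam s : ℝ} (hlam : 0 < lam) (hs : lam < s)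
    (hs4 : s ≤ 4 * lam) :
    4 ^ ((1 : ℝ) - n) * ((s - lam) * lam ^ (-(n : ℝ))) ≤ (s - lam) * s ^ ((1 : ℝ) - n) / lam ∧
      (s - lam) * s ^ ((1 : ℝ) - n) / lam ≤ (s - lam) * lam ^ (-(n : ℝ)) := by
  have hn' : (4 : ℝ) ≤ n := by exact_mod_cast hn
  have hd : 0 < s - lam := by linarith
  have e : lam ^ (-(n : ℝ)) = lam ^ ((1 : ℝ) - n) / lam := by
    rw [← Real.rpow_sub_one hlam.ne']
    congr 1
    ring
  have h1 : (4 * lam) ^ ((1 : ℝ) - n) ≤ s ^ ((1 : ℝ) - n) :=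
    Real.rpow_le_rpow_of_nonpos (by linarith) hs4 (by linarith)
  have h2 : s ^ ((1 : ℝ) - n) ≤ lam ^ ((1 : ℝ) - n) :=
    Real.rpow_le_rpow_of_nonpos hlam hs.le (by linarith)
  rw [e]
  constructor
  · calc _ = (s - lam) * (4 * lam) ^ ((1 : ℝ) - n) / lam := by
          rw [Real.mul_rpow (by norm_num) hlam.le]; ring
      _ ≤ _ := div_le_div_of_nonneg_right (mul_le_mul_of_nonneg_left h1 hd.le) hlam.le
  · calc _ ≤ (s - lam) * lam ^ ((1 : ℝ) - n) / lam :=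
          div_le_div_of_nonneg_right (mul_le_mul_of_nonneg_left h2 hd.le) hlam.le
      _ = _ := by ring

lemma profile_bounds_far {n : ℕ} (hn : 4 ≤ n) {lam s : ℝ} (hlam : 0 < lam)
    (hs4 : 4 * lam ≤ s) :
    4 ^ ((1 : ℝ) - n) * (s ^ ((2 : ℝ) - n) * lam⁻¹) ≤ (s - lam) * s ^ ((1 : ℝ) - n) / lam ∧
      (s - lam) * s ^ ((1 : ℝ) - n) / lam ≤ s ^ ((2 : ℝ) - n) * lam⁻¹ := by
  have hn' : (4 : ℝ) ≤ n := by exact_mod_cast hn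
  have hs0 : 0 < s := by linarith
  have e : s ^ ((2 : ℝ) - n) = s * s ^ ((1 : ℝ) - n) := by
    rw [show (2 : ℝ) - n = 1 + (1 - n) by ring, Real.rpow_add hs0, Real.rpow_one]
  rw [e, div_eq_mul_inv]
  constructor
  · have h4 : (4 : ℝ) ^ ((1 : ℝ) - n) ≤ 1 / 4 := by
      calc (4 : ℝ) ^ ((1 : ℝ) - n) ≤ 4 ^ (-1 : ℝ) :=
            Real.rpow_le_rpow_of_exponent_le (by norm_num) (by linarith)
        _ = 1 / 4 := by norm_num [Real.rpow_neg_one]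
    calc _ ≤ 1 / 4 * (s * s ^ ((1 : ℝ) - n) * lam⁻¹) := by gcongr
      _ = (1 / 4 * s) * s ^ ((1 : ℝ) - n) * lam⁻¹ := by ring
      _ ≤ _ := by gcongr; linarith
  · gcongr
    linarith

/-- estimates for the reflected Green potential
`h₁(y) = ∫_{Σ_λ} Ḡ_λ(y,η) Q(η) dη` on the half-space. -/
theorem reflected_green_potential_estimates (n : ℕ) (hn : 4 ≤ n) (h0 : 0 < n)
    (a₁ a₂ : ℝ) (ha₁ : 0 < a₁) (ha₂ : 0 < a₂) :
    ∃ R₀ : ℝ, 8 ≤ R₀ ∧ ∃ C₁ : ℝ, 0 < C₁ ∧ ∃ C₂ : ℝ, 0 < C₂ ∧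
      ∀ R : ℝ, R₀ ≤ R → ∀ lam ∈ Set.Icc R (R + 2),
      ∀ Γ : ℝ, 1 ≤ Γ → ∀ ρ : ℝ, 4 * lam ≤ ρ → ρ ≤ Γ →
      ∀ Q : Euc n → ℝ,
        ContinuousOn Q (SigSet n h0 lam ρ) →
        (∀ η ∈ OmegaSet n h0 lam ρ,
          Q η ≤ -a₁ * Γ⁻¹ * (‖η‖ - lam)
            * (1 + ‖η - lam • EuclideanSpace.single (⟨0, h0⟩ : Fin n) (1 : ℝ)‖ ^ 2)
              ^ (-(((n : ℝ) + 2) / 2))) →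
        (∀ η ∈ OmegaSet n h0 lam ρ, |Q η| ≤ a₂ * Γ⁻¹ * (‖η‖ - lam)) →
        (∀ η ∈ SigSet n h0 lam ρ \ OmegaSet n h0 lam ρ,
          |Q η| ≤ a₂ * Γ⁻¹ * (‖η‖ - lam) * ‖η‖ ^ (-(n : ℝ) - 2)) →
        ∀ y ∈ closure (SigSet n h0 lam ρ) ∩ closure (upperHalf n h0), lam < ‖y‖ →
          (‖y‖ ≤ 4 * lam →
            (∫ η in SigSet n h0 lam ρ, greenGbar n h0 lam y η * Q η)
                ≤ -C₁ * Γ⁻¹ * (‖y‖ - lam) * lam ^ (-(n : ℝ)) * Real.log lam ∧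
            |∫ η in SigSet n h0 lam ρ, greenGbar n h0 lam y η * Q η|
                ≤ C₂ * Γ⁻¹ * (‖y‖ - lam) * lam ^ 2) ∧
          (4 * lam ≤ ‖y‖ →
            (∫ η in SigSet n h0 lam ρ, greenGbar n h0 lam y η * Q η)
                ≤ -C₁ * Γ⁻¹ * ‖y‖ ^ ((2 : ℝ) - (n : ℝ)) * lam⁻¹ * Real.log lam ∧
            |∫ η in SigSet n h0 lam ρ, greenGbar n h0 lam y η * Q η|
                ≤ C₂ * Γ⁻¹ * ‖y‖ ^ ((2 : ℝ) - (n : ℝ)) * lam ^ ((n : ℝ) + 1)) := by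
  obtain ⟨R₀, hR₀, c, hc, C, hC, H⟩ := green_potential_bounds hn h0 ha₁ ha₂
  refine ⟨R₀, hR₀, 2 * c * 4 ^ ((1 : ℝ) - n), by positivity, 2 * C, by positivity, ?_⟩
  intro R hR lam hlam Γ hΓ ρ hρ _ Q hQc hQ1 hQ2 hQ3 y _ hy
  have hlamR : R₀ ≤ lam := hR.trans hlam.1
  have hlam0 : 0 < lam := by linarith
  have hlog : 0 ≤ Real.log lam := Real.log_nonneg (by linarith)
  have hγ : 0 < Γ⁻¹ := by positivity
  have hγlog : 0 ≤ 2 * c * Γ⁻¹ * Real.log lam := by positivity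
  obtain ⟨hi, hu, ha⟩ := H lam hlamR Γ⁻¹ hγ ρ hρ Q hQc hQ1 hQ2 hQ3 y hy
  obtain ⟨hi', hu', ha'⟩ := H lam hlamR Γ⁻¹ hγ ρ hρ Q hQc hQ1 hQ2 hQ3 (reflPt n h0 y)
    (by rwa [norm_reflPt])
  rw [norm_reflPt] at hu' ha'
  have hsum : ∫ η in SigSet n h0 lam ρ, greenGbar n h0 lam y η * Q η
      = (∫ η in SigSet n h0 lam ρ, greenG n lam y η * Q η)
        + ∫ η in SigSet n h0 lam ρ, greenG n lam (reflPt n h0 y) η * Q η := by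
    rw [← integral_add hi hi']
    simp only [greenGbar, add_mul]
  rw [hsum]
  have hup := add_le_add hu hu'
  have habs := (abs_add_le _ _).trans (add_le_add ha ha')
  have hCγ : 0 ≤ 2 * C * Γ⁻¹ * lam ^ ((n : ℝ) + 2) := by positivity
  have hpow1 : lam ^ ((n : ℝ) + 2) * lam ^ (-(n : ℝ)) = lam ^ 2 := by
    rw [← Real.rpow_add hlam0, ← Real.rpow_natCast]
    congr 1
    push_cast
    ring
  have hpow2 : lam ^ ((n : ℝ) + 2) * lam⁻¹ = lam ^ ((n : ℝ) + 1) := by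
    rw [← Real.rpow_neg_one, ← Real.rpow_add hlam0]
    congr 1
    ring
  refine ⟨fun hy4 => ?_, fun hy4 => ?_⟩
  · obtain ⟨hl, hr⟩ := profile_bounds_near hn hlam0 hy hy4
    refine ⟨hup.trans ?_, habs.trans ?_⟩
    · linarith [mul_le_mul_of_nonneg_left hl hγlog]
    · rw [← hpow1]
      linarith [mul_le_mul_of_nonneg_left hr hCγ]
  · obtain ⟨hl, hr⟩ := profile_bounds_far hn hlam0 hy4
    refine ⟨hup.trans ?_, habs.trans ?_⟩
    · linarith [mul_le_mul_of_nonneg_left hl hγlog]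
    · rw [← hpow2]
      linarith [mul_le_mul_of_nonneg_left hr hCγ]
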